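/- ζ_MT(2,2,2,2,2) = 7ζ(10) + 36 [ 5ζ(8,2) + 10ζ(9,1) − 4ζ(2)ζ(6,2) − 8ζ(2)ζ(7,1) ]. -/

import Mathlib

/-- The Mordell–Tornheim zeta value `ζ_MT(s₁,…,s_{k+1})` of depth `k`. -/
noncomputable def MTZ {k : ℕ} (s : Fin (k + 1) → ℕ) : ℝ :=
  ∑' m : Fin k → ℕ+,
    (∏ j : Fin k, ((m j : ℕ) : ℝ) ^ s j.castSucc)⁻¹ *
      ((∑ j : Fin k, ((m j : ℕ) : ℝ)) ^ s (Fin.last k))⁻¹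

/-- The multiple zeta value `ζ(n₁,…,n_d)` (summed over `m₁ > m₂ > ⋯ > m_d ≥ 1`);
for `d = 1` this is the Riemann zeta value. -/
noncomputable def MZV {d : ℕ} (n : Fin d → ℕ) : ℝ :=
  ∑' m : {m : Fin d → ℕ+ // ∀ i j : Fin d, i < j → m j < m i},
    (∏ i : Fin d, ((m.1 i : ℕ) : ℝ) ^ n i)⁻¹


section CircleFourier

open AddCircle MeasureTheory

lemma fourierCoeff_zero_eq_integral (f : C(UnitAddCircle, ℂ)) :
    fourierCoeff f 0 = ∫ t, f t ∂haarAddCircle := by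
  simp [fourierCoeff]

/-- The integral over the unit circle, as a continuous linear functional. -/
noncomputable def circleMean : C(UnitAddCircle, ℂ) →L[ℂ] ℂ :=
  LinearMap.mkContinuous
    { toFun := fun f => ∫ t, f t ∂haarAddCircle
      map_add' := fun f g => by
        have hf := f.continuous.integrable_of_hasCompactSupport (μ := haarAddCircle)
          (HasCompactSupport.of_compactSpace _)
        have hg := g.continuous.integrable_of_hasCompactSupport (μ := haarAddCircle)
          (HasCompactSupport.of_compactSpace _)
        simpa using integral_add hf hg
      map_smul' := fun c f => by simp [integral_const_mul] }
    1 (fun f => by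
      have := norm_integral_le_of_norm_le_const (μ := haarAddCircle (T := 1))
        (Filter.Eventually.of_forall fun t => f.norm_coe_le_norm t)
      simpa [mul_comm] using this)

lemma circleMean_apply (f : C(UnitAddCircle, ℂ)) :
    circleMean f = ∫ t, f t ∂haarAddCircle := rfl

lemma circleMean_fourier_mul (n : ℤ) (f : C(UnitAddCircle, ℂ)) :
    circleMean (fourier n * f) = fourierCoeff f (-n) := by
  simp [circleMean_apply, fourierCoeff]

lemma fourier_mul_fourier (m n : ℤ) :
    (fourier m * fourier n : C(UnitAddCircle, ℂ)) = fourier (m + n) := by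
  ext x
  exact fourier_add.symm

lemma circleMean_fourier (n : ℤ) :
    circleMean (fourier n) = if n = 0 then 1 else 0 := by
  have h := orthonormal_iff_ite.mp (orthonormal_fourier (T := 1)) 0 n
  rw [ContinuousMap.inner_toLp (@haarAddCircle 1 _) (fourier 0) (fourier n)] at h
  rw [circleMean_apply]
  simpa [eq_comm] using h

/-- The terms of the Fourier series `∑ e(ε n t) / n ^ 2`. -/
noncomputable def dilogTerm (ε : ℤ) (n : ℕ+) : C(UnitAddCircle, ℂ) :=
  ((n : ℂ) ^ 2)⁻¹ • fourier (ε * n)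

/-- The function `t ↦ Li₂ (e(ε t))`. -/
noncomputable def dilogCircle (ε : ℤ) : C(UnitAddCircle, ℂ) := ∑' n, dilogTerm ε n

lemma summable_norm_dilogTerm (ε : ℤ) : Summable fun n => ‖dilogTerm ε n‖ := by
  have h : Summable fun n : ℕ => ((n : ℝ) ^ 2)⁻¹ := Real.summable_nat_pow_inv.mpr one_lt_two
  refine (h.comp_injective PNat.coe_injective).congr fun n => ?_
  simp [dilogTerm, norm_smul, fourier_norm]

lemma hasSum_dilogTerm (ε : ℤ) : HasSum (dilogTerm ε) (dilogCircle ε) :=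
  (summable_norm_dilogTerm ε).of_norm.hasSum

lemma HasSum.sq_of_summable_norm {ι R : Type*} [NormedCommRing R] [CompleteSpace R] {f : ι → R}
    {a : R} (h : HasSum f a) (hf : Summable fun i => ‖f i‖) :
    HasSum (fun p : ι × ι => f p.1 * f p.2) (a ^ 2) := by
  rw [pow_two]
  exact h.mul h (summable_mul_of_summable_norm hf hf)

lemma hasSum_dilogTerm_sq (ε : ℤ) :
    HasSum (fun p : ℕ+ × ℕ+ => dilogTerm ε p.1 * dilogTerm ε p.2) (dilogCircle ε ^ 2) :=
  (hasSum_dilogTerm ε).sq_of_summable_norm (summable_norm_dilogTerm ε)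

lemma hasSum_dilogTerm_pow_four (ε : ℤ) :
    HasSum (fun p : (ℕ+ × ℕ+) × (ℕ+ × ℕ+) =>
      dilogTerm ε p.1.1 * dilogTerm ε p.1.2 * (dilogTerm ε p.2.1 * dilogTerm ε p.2.2))
      (dilogCircle ε ^ 4) := by
  have h := (hasSum_dilogTerm_sq ε).sq_of_summable_norm
    ((summable_norm_dilogTerm ε).mul_norm (summable_norm_dilogTerm ε))
  rwa [← pow_mul] at h

lemma hasSum_circleMean_sq_mul (ε : ℤ) (f : C(UnitAddCircle, ℂ)) :
    HasSum (fun p : ℕ+ × ℕ+ => ((p.1 : ℂ) ^ 2)⁻¹ * ((p.2 : ℂ) ^ 2)⁻¹ *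
      fourierCoeff f (-(ε * (p.1 + p.2 : ℕ+)))) (circleMean (dilogCircle ε ^ 2 * f)) := by
  convert! circleMean.hasSum ((hasSum_dilogTerm_sq ε).mul_right f) using 2 with p
  rw [← circleMean_fourier_mul]
  simp only [dilogTerm, smul_mul_assoc, mul_smul_comm, map_smul, fourier_mul_fourier, smul_eq_mul]
  rw [PNat.add_coe]
  push_cast
  ring_nf

lemma hasSum_circleMean_pow_four_mul (ε : ℤ) (f : C(UnitAddCircle, ℂ)) :
    HasSum (fun p : (ℕ+ × ℕ+) × (ℕ+ × ℕ+) =>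
      ((p.1.1 : ℂ) ^ 2)⁻¹ * ((p.1.2 : ℂ) ^ 2)⁻¹ * (((p.2.1 : ℂ) ^ 2)⁻¹ * ((p.2.2 : ℂ) ^ 2)⁻¹) *
      fourierCoeff f (-(ε * (p.1.1 + p.1.2 + p.2.1 + p.2.2 : ℕ+))))
      (circleMean (dilogCircle ε ^ 4 * f)) := by
  convert! circleMean.hasSum ((hasSum_dilogTerm_pow_four ε).mul_right f) using 2 with p
  rw [← circleMean_fourier_mul]
  simp only [dilogTerm, smul_mul_assoc, mul_smul_comm, map_smul, fourier_mul_fourier, smul_eq_mul]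
  simp only [PNat.add_coe]
  push_cast
  ring_nf

lemma hasSum_fourierCoeff_dilogCircle (ε k : ℤ) :
    HasSum (fun n : ℕ+ => ((n : ℂ) ^ 2)⁻¹ * if ε * n = k then 1 else 0)
      (fourierCoeff (dilogCircle ε) k) := by
  rw [← neg_neg k, ← circleMean_fourier_mul]
  convert! circleMean.hasSum ((hasSum_dilogTerm ε).mul_left (fourier (-k))) using 2 with n
  simp only [dilogTerm, mul_smul_comm, map_smul, fourier_mul_fourier, smul_eq_mul,
    circleMean_fourier]
  congr 2
  rw [neg_neg, neg_add_eq_zero]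
  exact propext eq_comm

lemma fourierCoeff_dilogCircle_self {ε : ℤ} (hε : ε ≠ 0) (n : ℕ+) :
    fourierCoeff (dilogCircle ε) (ε * n) = ((n : ℂ) ^ 2)⁻¹ := by
  refine (hasSum_fourierCoeff_dilogCircle ε _).unique ?_
  convert! hasSum_ite_eq n (((n : ℂ) ^ 2)⁻¹) using 2 with m
  by_cases h : m = n
  · simp [h]
  · have : ¬ (ε * (m : ℕ) = ε * (n : ℕ)) := fun h' => h <| PNat.coe_injective <| by
      exact_mod_cast mul_left_cancel₀ hε h'
    simp [h, hε]

lemma fourierCoeff_dilogCircle_neg {ε : ℤ} (hε : ε ≠ 0) (n : ℕ+) :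
    fourierCoeff (dilogCircle ε) (-(ε * n)) = 0 := by
  refine (hasSum_fourierCoeff_dilogCircle ε _).unique ?_
  convert! hasSum_zero using 2 with m
  have : ε * (m : ℕ) ≠ -(ε * (n : ℕ)) := fun h => by
    have h2 : ε * ((m : ℕ) + (n : ℕ) : ℤ) = 0 := by linear_combination h
    have hm := m.pos
    rcases mul_eq_zero.mp h2 with h | h
    · exact hε h
    · omega
  simp [this]

/-- The Bernoulli polynomial `B_k`, as a continuous function on the circle. -/
noncomputable def bernoulliCircle (k : ℕ) (hk : k ≠ 1) : C(UnitAddCircle, ℂ) :=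
  ⟨(↑) ∘ periodizedBernoulli k, Complex.continuous_ofReal.comp (periodizedBernoulli.continuous hk)⟩

lemma fourierCoeff_bernoulliCircle {k : ℕ} (hk : k ≠ 1) (h0 : k ≠ 0) (n : ℤ) :
    fourierCoeff (bernoulliCircle k hk) n =
      -(k.factorial : ℂ) / (2 * Real.pi * Complex.I * n) ^ k :=
  fourierCoeff_bernoulli_eq h0 n

lemma dilogCircle_add_dilogCircle_neg :
    dilogCircle 1 + dilogCircle (-1) =
      (2 * (Real.pi : ℂ) ^ 2) • bernoulliCircle 2 (by decide) := by
  have hpi : (Real.pi : ℂ) ≠ 0 := by exact_mod_cast Real.pi_ne_zero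
  have hc (n : ℤ) : fourierCoeff (bernoulliCircle 2 (by decide)) n =
      (2 * (Real.pi : ℂ) ^ 2)⁻¹ * ((n : ℂ) ^ 2)⁻¹ := by
    rw [fourierCoeff_bernoulliCircle _ (by decide)]
    rcases eq_or_ne n 0 with rfl | hn
    · simp
    · have hn' : (n : ℂ) ≠ 0 := by exact_mod_cast hn
      simp only [mul_pow, Complex.I_sq, Nat.factorial]
      push_cast
      field_simp
  have hpos := Equiv.pnatEquivNat.symm.hasSum_iff.mpr (hasSum_dilogTerm 1)
  have hneg := Equiv.pnatEquivNat.symm.hasSum_iff.mpr (hasSum_dilogTerm (-1))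
  have h := HasSum.of_add_one_of_neg_add_one
    (f := fun n : ℤ => ((n : ℂ) ^ 2)⁻¹ • (fourier n : C(UnitAddCircle, ℂ)))
    (m := dilogCircle 1) (m' := dilogCircle (-1))
    (by
      convert! hpos using 2 with n
      simp [dilogTerm])
    (by
      convert! hneg using 2 with n
      have hn : ((-(n + 1) : ℂ) ^ 2)⁻¹ = ((n + 1 : ℂ) ^ 2)⁻¹ := by rw [neg_sq]
      simpa [dilogTerm, add_comm] using congrArg (· • _) hn)
  have hs : Summable (fourierCoeff (bernoulliCircle 2 (by decide))) := by
    have := (summable_bernoulli_fourier le_rfl : Summable _)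
    exact this.congr fun n => (fourierCoeff_bernoulliCircle _ (by decide) n).symm
  have h' := (hasSum_fourier_series_of_summable hs).const_smul (2 * (Real.pi : ℂ) ^ 2)
  refine (HasSum.unique ?_ h')
  convert! h using 2
  · rw [hc, smul_smul]
    congr 1
    field_simp
  · ext x
    simp

lemma bernoulli_four : bernoulli 4 = -1 / 30 := by
  rw [bernoulli_eq_bernoulli'_of_ne_one (by decide), bernoulli'_four]

lemma bernoulli'_six : bernoulli' 6 = 1 / 42 := by
  have h5 : bernoulli' 5 = 0 := bernoulli'_eq_zero_of_odd (by decide) (by decide)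
  rw [bernoulli'_def]
  simp [Finset.sum_range_succ, h5, Nat.choose]
  norm_num

lemma bernoulli'_eight : bernoulli' 8 = -1 / 30 := by
  have h5 : bernoulli' 5 = 0 := bernoulli'_eq_zero_of_odd (by decide) (by decide)
  have h7 : bernoulli' 7 = 0 := bernoulli'_eq_zero_of_odd (by decide) (by decide)
  rw [bernoulli'_def]
  simp [Finset.sum_range_succ, h5, h7, bernoulli'_six, Nat.choose]
  norm_num

lemma bernoulli'_ten : bernoulli' 10 = 5 / 66 := by
  have h5 : bernoulli' 5 = 0 := bernoulli'_eq_zero_of_odd (by decide) (by decide)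
  have h7 : bernoulli' 7 = 0 := bernoulli'_eq_zero_of_odd (by decide) (by decide)
  have h9 : bernoulli' 9 = 0 := bernoulli'_eq_zero_of_odd (by decide) (by decide)
  rw [bernoulli'_def]
  simp [Finset.sum_range_succ, h5, h7, h9, bernoulli'_six, bernoulli'_eight, Nat.choose]
  norm_num

lemma bernoulliFun_four (x : ℝ) : bernoulliFun 4 x = x ^ 4 - 2 * x ^ 3 + x ^ 2 - 1 / 30 := by
  have h3 : bernoulli 3 = 0 := bernoulli_eq_zero_of_odd (by decide) (by decide)
  simp [bernoulliFun, Polynomial.bernoulli_def, Finset.sum_range_succ, h3, bernoulli_four,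
    Nat.choose]
  ring

lemma bernoulliFun_six (x : ℝ) : bernoulliFun 6 x =
    x ^ 6 - 3 * x ^ 5 + 5 / 2 * x ^ 4 - 1 / 2 * x ^ 2 + 1 / 42 := by
  have h3 : bernoulli 3 = 0 := bernoulli_eq_zero_of_odd (by decide) (by decide)
  have h5 : bernoulli 5 = 0 := bernoulli_eq_zero_of_odd (by decide) (by decide)
  have h6 : bernoulli 6 = 1 / 42 := by
    rw [bernoulli_eq_bernoulli'_of_ne_one (by decide), bernoulli'_six]
  simp [bernoulliFun, Polynomial.bernoulli_def, Finset.sum_range_succ, h3, h5, h6, bernoulli_four,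
    Nat.choose]
  ring

lemma bernoulliCircle_two_pow_three :
    bernoulliCircle 2 (by decide) ^ 3 = bernoulliCircle 6 (by decide) +
      bernoulliCircle 4 (by decide) + (1 / 12 : ℂ) • bernoulliCircle 2 (by decide) +
      (1 / 3780 : ℂ) • 1 := by
  have h (y : ℝ) : bernoulliFun 2 y ^ 3 = bernoulliFun 6 y + bernoulliFun 4 y +
      1 / 12 * bernoulliFun 2 y + 1 / 3780 := by
    rw [bernoulliFun_two, bernoulliFun_four, bernoulliFun_six]
    ring
  ext x
  have hx := congrArg (fun r : ℝ => (r : ℂ)) (h (equivIco 1 0 x))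
  push_cast at hx
  simp only [ContinuousMap.pow_apply, ContinuousMap.add_apply, ContinuousMap.smul_apply,
    ContinuousMap.one_apply, smul_eq_mul, mul_one]
  exact hx

lemma circleMean_bernoulliCircle_pow (j : ℕ) :
    circleMean (bernoulliCircle 2 (by decide) ^ j) =
      ((∫ x in (0 : ℝ)..1, (x ^ 2 - x + 1 / 6) ^ j : ℝ) : ℂ) := by
  have h := fourierCoeff_liftIco_eq (T := 1) (a := 0)
    (fun x : ℝ => (((x ^ 2 - x + 1 / 6) ^ j : ℝ) : ℂ)) 0
  rw [fourierCoeffOn_eq_integral] at h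
  have h1 : AddCircle.liftIco 1 0 (fun x : ℝ => (((x ^ 2 - x + 1 / 6) ^ j : ℝ) : ℂ)) =
      ⇑(bernoulliCircle 2 (by decide) ^ j) := by
    ext x
    change _ = ((bernoulliFun 2 (equivIco 1 0 x) : ℝ) : ℂ) ^ j
    rw [bernoulliFun_two, ← one_div]
    norm_cast
  rw [h1, fourierCoeff_zero_eq_integral, ← circleMean_apply] at h
  rw [h, ← intervalIntegral.integral_ofReal]
  simp

lemma circleMean_bernoulliCircle_pow_three :
    circleMean (bernoulliCircle 2 (by decide) ^ 3) = 1 / 3780 := by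
  have h : ∫ x in (0 : ℝ)..1, (x ^ 2 - x + 1 / 6) ^ 3 = 1 / 3780 := by
    ring_nf
    simp (disch := (apply Continuous.intervalIntegrable; fun_prop))
      [intervalIntegral.integral_add, intervalIntegral.integral_sub]
    norm_num
  rw [circleMean_bernoulliCircle_pow, h]
  norm_num

lemma circleMean_bernoulliCircle_pow_five :
    circleMean (bernoulliCircle 2 (by decide) ^ 5) = 1 / 149688 := by
  have h : ∫ x in (0 : ℝ)..1, (x ^ 2 - x + 1 / 6) ^ 5 = 1 / 149688 := by
    ring_nf
    simp (disch := (apply Continuous.intervalIntegrable; fun_prop))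
      [intervalIntegral.integral_add, intervalIntegral.integral_sub]
    norm_num
  rw [circleMean_bernoulliCircle_pow, h]
  norm_num

lemma fourierCoeff_bernoulliCircle_two_pow_three {n : ℤ} (hn : n ≠ 0) :
    fourierCoeff ⇑(bernoulliCircle 2 (by decide) ^ 3) n =
      45 / (4 * (Real.pi : ℂ) ^ 6 * (n : ℂ) ^ 6) - 3 / (2 * (Real.pi : ℂ) ^ 4 * (n : ℂ) ^ 4) +
        1 / (24 * (Real.pi : ℂ) ^ 2 * (n : ℂ) ^ 2) := by
  have hpi : (Real.pi : ℂ) ≠ 0 := by exact_mod_cast Real.pi_ne_zero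
  have hn' : (n : ℂ) ≠ 0 := by exact_mod_cast hn
  have h1 : circleMean (fourier (-n) * 1) = 0 := by
    rw [mul_one, circleMean_fourier, if_neg (neg_ne_zero.mpr hn)]
  have hI4 : Complex.I ^ 4 = 1 := by rw [show 4 = 2 * 2 from rfl, pow_mul, Complex.I_sq]; ring
  have hI6 : Complex.I ^ 6 = -1 := by rw [show 6 = 2 * 3 from rfl, pow_mul, Complex.I_sq]; ring
  have h := circleMean_fourier_mul (-n) (bernoulliCircle 2 (by decide) ^ 3)
  rw [neg_neg] at h
  rw [← h, bernoulliCircle_two_pow_three]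
  simp only [mul_add, mul_smul_comm, map_add, map_smul, h1]
  simp only [circleMean_fourier_mul, neg_neg]
  rw [fourierCoeff_bernoulliCircle _ (by decide), fourierCoeff_bernoulliCircle _ (by decide),
    fourierCoeff_bernoulliCircle _ (by decide)]
  simp only [mul_pow, Complex.I_sq, hI4, hI6, Nat.factorial, smul_eq_mul]
  push_cast
  field_simp
  ring

end CircleFourier

section MultipleZeta

/-- The pairs of positive integers `m₁ > m₂`, parametrized by `(m₁ - m₂, m₂)`. -/
def strictPairEquiv :
    ℕ+ × ℕ+ ≃ {m : Fin 2 → ℕ+ // ∀ i j : Fin 2, i < j → m j < m i} where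
  toFun p := ⟨![p.1 + p.2, p.2], fun i j hij => by
    fin_cases i <;> fin_cases j <;> simp_all [PNat.lt_add_left]⟩
  invFun m := (m.1 0 - m.1 1, m.1 1)
  left_inv p := by
    ext <;> simp
  right_inv m := by
    have h : m.1 1 < m.1 0 := m.2 0 1 (by decide)
    ext i
    fin_cases i
    · simpa [add_comm] using PNat.add_sub_of_lt h
    · simp

/-- Functions on `Fin 4` as pairs of pairs. -/
def finFourFunEquiv (α : Type*) : (α × α) × (α × α) ≃ (Fin 4 → α) where
  toFun p := ![p.1.1, p.1.2, p.2.1, p.2.2]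
  invFun m := ((m 0, m 1), (m 2, m 3))
  left_inv p := rfl
  right_inv m := by
    ext i
    fin_cases i <;> rfl

lemma MZV_one_eq_tsum (k : ℕ) : MZV (d := 1) ![k] = ∑' n : ℕ+, ((n : ℝ) ^ k)⁻¹ := by
  let e : ℕ+ ≃ {m : Fin 1 → ℕ+ // ∀ i j : Fin 1, i < j → m j < m i} :=
    { toFun := fun n => ⟨![n], fun i j hij => absurd hij (by simp [Subsingleton.elim i j])⟩
      invFun := fun m => m.1 0
      left_inv := fun n => rfl
      right_inv := fun m => by
        ext i
        fin_cases i
        rfl }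
  have he (n : ℕ+) : (e n).1 0 = n := rfl
  rw [MZV, ← e.tsum_eq]
  simp [he]

lemma MZV_one_two_mul {k : ℕ} (hk : k ≠ 0) :
    MZV (d := 1) ![2 * k] = (-1 : ℝ) ^ (k + 1) * (2 : ℝ) ^ (2 * k - 1) * Real.pi ^ (2 * k) *
      bernoulli (2 * k) / (2 * k).factorial := by
  rw [MZV_one_eq_tsum, ← (hasSum_zeta_nat hk).tsum_eq,
    ← tsum_zero_pnat_eq_tsum_nat (hasSum_zeta_nat hk).summable]
  simp [hk]

lemma MZV_two : MZV (d := 1) ![2] = Real.pi ^ 2 / 6 := by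
  rw [show (2 : ℕ) = 2 * 1 from rfl, MZV_one_two_mul one_ne_zero]
  simp [Nat.factorial]
  ring

lemma MZV_ten : MZV (d := 1) ![10] = Real.pi ^ 10 / 93555 := by
  rw [show (10 : ℕ) = 2 * 5 from rfl, MZV_one_two_mul (by decide),
    bernoulli_eq_bernoulli'_of_ne_one (by decide), bernoulli'_ten]
  simp [Nat.factorial]
  ring

lemma hasSum_MZV_pair {p : ℕ} (q : ℕ) (hp : 4 ≤ p) :
    HasSum (fun x : ℕ+ × ℕ+ => (((x.1 : ℝ) + x.2) ^ p * (x.2 : ℝ) ^ q)⁻¹)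
      (MZV (d := 2) ![p, q]) := by
  have hs : Summable fun n : ℕ+ => ((n : ℝ) ^ 2)⁻¹ :=
    (Real.summable_nat_pow_inv.mpr one_lt_two).comp_injective PNat.coe_injective
  have hsum : Summable fun x : ℕ+ × ℕ+ => (((x.1 : ℝ) + x.2) ^ p * (x.2 : ℝ) ^ q)⁻¹ := by
    refine Summable.of_nonneg_of_le (fun x => by positivity) (fun x => ?_)
      (hs.mul_of_nonneg hs (fun _ => by positivity) (fun _ => by positivity))
    have h1 : (1 : ℝ) ≤ x.1 := by exact_mod_cast x.1.pos
    have h2 : (1 : ℝ) ≤ x.2 := by exact_mod_cast x.2.pos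
    rw [← mul_inv]
    refine inv_anti₀ (by positivity) ?_
    calc (x.1 : ℝ) ^ 2 * (x.2 : ℝ) ^ 2 ≤ ((x.1 : ℝ) + x.2) ^ 2 * ((x.1 : ℝ) + x.2) ^ 2 := by
          gcongr <;> linarith
      _ = ((x.1 : ℝ) + x.2) ^ 4 := by ring
      _ ≤ ((x.1 : ℝ) + x.2) ^ p := pow_le_pow_right₀ (by linarith) hp
      _ ≤ ((x.1 : ℝ) + x.2) ^ p * (x.2 : ℝ) ^ q :=
          le_mul_of_one_le_right (by positivity) (one_le_pow₀ h2)
  convert! hsum.hasSum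
  rw [MZV, ← strictPairEquiv.tsum_eq]
  simp [strictPairEquiv, Fin.prod_univ_two]

lemma hasSum_inv_sq_mul_inv_sq_mul_inv_add_pow {s : ℕ} (hs : 2 ≤ s) :
    HasSum (fun x : ℕ+ × ℕ+ => ((x.1 : ℝ) ^ 2)⁻¹ * ((x.2 : ℝ) ^ 2)⁻¹ *
        (((x.1 : ℝ) + x.2) ^ s)⁻¹)
      (2 * MZV (d := 2) ![s + 2, 2] + 4 * MZV (d := 2) ![s + 3, 1]) := by
  have h2 := hasSum_MZV_pair (p := s + 2) 2 (by omega)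
  have h1 := hasSum_MZV_pair (p := s + 3) 1 (by omega)
  have h2' := (Equiv.prodComm ℕ+ ℕ+).hasSum_iff.mpr h2
  have h1' := (Equiv.prodComm ℕ+ ℕ+).hasSum_iff.mpr h1
  convert! (h2.add h2').add ((h1.add h1').mul_left 2) using 1
  · ext x
    have ha : (x.1 : ℝ) ≠ 0 := by exact_mod_cast x.1.ne_zero
    have hb : (x.2 : ℝ) ≠ 0 := by exact_mod_cast x.2.ne_zero
    have hab : (x.1 : ℝ) + x.2 ≠ 0 := by positivity
    simp only [Function.comp_apply, Equiv.prodComm_apply, Prod.fst_swap, Prod.snd_swap, pow_add,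
      add_comm (x.2 : ℝ)]
    field_simp
    ring
  · ring

end MultipleZeta

section MordellTornheim

lemma circleMean_dilogCircle_pow_four_mul_neg {ε : ℤ} (hε : ε ≠ 0) :
    circleMean (dilogCircle ε ^ 4 * dilogCircle (-ε)) = (MTZ (k := 4) ![2, 2, 2, 2, 2] : ℝ) := by
  rw [MTZ, ← (finFourFunEquiv ℕ+).tsum_eq, Complex.ofReal_tsum,
    ← (hasSum_circleMean_pow_four_mul ε (dilogCircle (-ε))).tsum_eq]
  have he (p : (ℕ+ × ℕ+) × (ℕ+ × ℕ+)) :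
      finFourFunEquiv ℕ+ p = ![p.1.1, p.1.2, p.2.1, p.2.2] := rfl
  congr 1
  ext p
  rw [← neg_mul, fourierCoeff_dilogCircle_self (neg_ne_zero.mpr hε), he]
  simp [Fin.prod_univ_four, Fin.sum_univ_four, Fin.last]
  exact Or.inl (by ring)

lemma circleMean_dilogCircle_pow_five {ε : ℤ} (hε : ε ≠ 0) :
    circleMean (dilogCircle ε ^ 5) = 0 := by
  rw [pow_succ]
  refine (hasSum_circleMean_pow_four_mul ε (dilogCircle ε)).unique ?_
  simp only [fourierCoeff_dilogCircle_neg hε, mul_zero, hasSum_zero]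

lemma circleMean_dilogCircle_pow_three {ε : ℤ} (hε : ε ≠ 0) :
    circleMean (dilogCircle ε ^ 3) = 0 := by
  rw [pow_succ]
  refine (hasSum_circleMean_sq_mul ε (dilogCircle ε)).unique ?_
  simp only [fourierCoeff_dilogCircle_neg hε, mul_zero, hasSum_zero]

lemma hasSum_ofReal_inv_sq {s : ℕ} (hs : 2 ≤ s) :
    HasSum (fun x : ℕ+ × ℕ+ => ((x.1 : ℂ) ^ 2)⁻¹ * ((x.2 : ℂ) ^ 2)⁻¹ *
        (((x.1 : ℂ) + x.2) ^ s)⁻¹)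
      (2 * (MZV (d := 2) ![s + 2, 2] : ℂ) + 4 * (MZV (d := 2) ![s + 3, 1] : ℂ)) := by
  simpa using Complex.hasSum_ofReal.mpr (hasSum_inv_sq_mul_inv_sq_mul_inv_add_pow hs)

lemma circleMean_dilogCircle_sq_mul_neg {ε : ℤ} (hε : ε ≠ 0) :
    circleMean (dilogCircle ε ^ 2 * dilogCircle (-ε)) =
      2 * (MZV (d := 2) ![4, 2] : ℂ) + 4 * (MZV (d := 2) ![5, 1] : ℂ) := by
  refine (hasSum_circleMean_sq_mul ε (dilogCircle (-ε))).unique ?_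
  convert! hasSum_ofReal_inv_sq (s := 2) le_rfl using 2 with p
  rw [← neg_mul, fourierCoeff_dilogCircle_self (neg_ne_zero.mpr hε)]
  simp

lemma circleMean_dilogCircle_sq_mul_bernoulliCircle {ε : ℤ} (hε : ε ^ 2 = 1) :
    (Real.pi : ℂ) ^ 6 * circleMean (dilogCircle ε ^ 2 * bernoulliCircle 2 (by decide) ^ 3) =
      45 / 4 * (2 * (MZV (d := 2) ![8, 2] : ℂ) + 4 * (MZV (d := 2) ![9, 1] : ℂ)) -
        3 / 2 * (Real.pi : ℂ) ^ 2 *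
          (2 * (MZV (d := 2) ![6, 2] : ℂ) + 4 * (MZV (d := 2) ![7, 1] : ℂ)) +
        (Real.pi : ℂ) ^ 4 / 24 *
          (2 * (MZV (d := 2) ![4, 2] : ℂ) + 4 * (MZV (d := 2) ![5, 1] : ℂ)) := by
  have hpi : (Real.pi : ℂ) ≠ 0 := by exact_mod_cast Real.pi_ne_zero
  refine ((hasSum_circleMean_sq_mul ε (bernoulliCircle 2 (by decide) ^ 3)).mul_left _).unique ?_
  have h := (((hasSum_ofReal_inv_sq (s := 6) (by decide)).mul_left
      (45 / 4 : ℂ)).sub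
    ((hasSum_ofReal_inv_sq (s := 4) (by decide)).mul_left (3 / 2 * (Real.pi : ℂ) ^ 2))).add
    ((hasSum_ofReal_inv_sq (s := 2) (by decide)).mul_left ((Real.pi : ℂ) ^ 4 / 24))
  convert! h using 2 with p
  have hε0 : ε ≠ 0 := by
    rintro rfl
    simp at hε
  have hn : -(ε * ((p.1 + p.2 : ℕ+) : ℕ)) ≠ 0 :=
    neg_ne_zero.mpr (mul_ne_zero hε0 (by exact_mod_cast (p.1 + p.2).ne_zero))
  have hε2 : (ε : ℂ) ^ 2 = 1 := by exact_mod_cast hε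
  have hε4 : (ε : ℂ) ^ 4 = 1 := by rw [show 4 = 2 * 2 from rfl, pow_mul, hε2, one_pow]
  have hε6 : (ε : ℂ) ^ 6 = 1 := by rw [show 6 = 2 * 3 from rfl, pow_mul, hε2, one_pow]
  rw [fourierCoeff_bernoulliCircle_two_pow_three hn]
  push_cast
  rw [Even.neg_pow (by decide), Even.neg_pow (by decide), Even.neg_pow (by decide),
    mul_pow, mul_pow, mul_pow, hε2, hε4, hε6]
  have ha : (p.1 : ℂ) ≠ 0 := by exact_mod_cast p.1.ne_zero
  have hb : (p.2 : ℂ) ≠ 0 := by exact_mod_cast p.2.ne_zero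
  have hab : (p.1 : ℂ) + p.2 ≠ 0 := by exact_mod_cast (p.1 + p.2).ne_zero
  field_simp

lemma pi_pow_six_eq_MZV :
    4 / 3 * (Real.pi : ℂ) ^ 6 / 3780 =
      2 * (MZV (d := 2) ![4, 2] : ℂ) + 4 * (MZV (d := 2) ![5, 1] : ℂ) := by
  have h1 : (1 : ℤ) ≠ 0 := one_ne_zero
  have h2 : (-1 : ℤ) ≠ 0 := by decide
  have hZ := circleMean_dilogCircle_sq_mul_neg h1
  have hW := circleMean_dilogCircle_sq_mul_neg h2
  rw [neg_neg] at hW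
  have h := congrArg (fun f => circleMean (f ^ 3)) dilogCircle_add_dilogCircle_neg
  have hexp (Z W : C(UnitAddCircle, ℂ)) :
      (Z + W) ^ 3 = Z ^ 3 + 3 • (Z ^ 2 * W) + 3 • (W ^ 2 * Z) + W ^ 3 := by
    simp only [nsmul_eq_mul]
    push_cast
    ring
  simp only [hexp, smul_pow, map_add, map_nsmul, map_smul, hZ, hW,
    circleMean_dilogCircle_pow_three h1, circleMean_dilogCircle_pow_three h2,
    circleMean_bernoulliCircle_pow_three] at h
  simp only [nsmul_eq_mul, smul_eq_mul] at h
  push_cast at h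
  linear_combination (-1 / 6) * h

end MordellTornheim

theorem stmt18 :
    MTZ (k := 4) ![2, 2, 2, 2, 2]
      = 7 * MZV (d := 1) ![10]
        + 36 * (5 * MZV (d := 2) ![8, 2] + 10 * MZV (d := 2) ![9, 1]
            - 4 * MZV (d := 1) ![2] * MZV (d := 2) ![6, 2]
            - 8 * MZV (d := 1) ![2] * MZV (d := 2) ![7, 1]) := by
  have hpi : (Real.pi : ℂ) ≠ 0 := by exact_mod_cast Real.pi_ne_zero
  have h1 : (1 : ℤ) ≠ 0 := one_ne_zero
  have h2 : (-1 : ℤ) ≠ 0 := by decide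
  have hZ := circleMean_dilogCircle_pow_four_mul_neg h1
  have hW := circleMean_dilogCircle_pow_four_mul_neg h2
  rw [neg_neg] at hW
  have hZ5 := circleMean_dilogCircle_pow_five h1
  have hW5 := circleMean_dilogCircle_pow_five h2
  have hJZ := circleMean_dilogCircle_sq_mul_bernoulliCircle (ε := 1) (by decide)
  have hJW := circleMean_dilogCircle_sq_mul_bernoulliCircle (ε := -1) (by decide)
  have hsum := dilogCircle_add_dilogCircle_neg
  have h5 := congrArg (fun f => circleMean (f ^ 5)) hsum
  have h3Z := congrArg (fun f => circleMean (dilogCircle 1 ^ 2 * f ^ 3)) hsum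
  have h3W := congrArg (fun f => circleMean (dilogCircle (-1) ^ 2 * f ^ 3)) hsum
  have hexp5 (Z W : C(UnitAddCircle, ℂ)) : (Z + W) ^ 5 = Z ^ 5 + 5 • (Z ^ 4 * W) +
      10 • (Z ^ 3 * W ^ 2) + 10 • (Z ^ 2 * W ^ 3) + 5 • (W ^ 4 * Z) + W ^ 5 := by
    simp only [nsmul_eq_mul]
    push_cast
    ring
  have hexpZ (Z W : C(UnitAddCircle, ℂ)) : Z ^ 2 * (Z + W) ^ 3 = Z ^ 5 + 3 • (Z ^ 4 * W) +
      3 • (Z ^ 3 * W ^ 2) + Z ^ 2 * W ^ 3 := by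
    simp only [nsmul_eq_mul]
    push_cast
    ring
  have hexpW (Z W : C(UnitAddCircle, ℂ)) : W ^ 2 * (Z + W) ^ 3 = W ^ 5 + 3 • (W ^ 4 * Z) +
      3 • (Z ^ 2 * W ^ 3) + Z ^ 3 * W ^ 2 := by
    simp only [nsmul_eq_mul]
    push_cast
    ring
  simp only [hexp5, smul_pow, map_add, map_nsmul, map_smul, hZ, hW, hZ5, hW5,
    circleMean_bernoulliCircle_pow_five] at h5
  simp only [hexpZ, smul_pow, mul_smul_comm, map_add, map_nsmul, map_smul, hZ, hZ5] at h3Z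
  simp only [hexpW, smul_pow, mul_smul_comm, map_add, map_nsmul, map_smul, hW, hW5] at h3W
  simp only [nsmul_eq_mul, smul_eq_mul] at h5 h3Z h3W
  push_cast at h5 h3Z h3W
  rw [MZV_two, MZV_ten]
  apply Complex.ofReal_injective
  push_cast
  linear_combination (1 / 2 : ℂ) * (h3Z + h3W) - (1 / 5 : ℂ) * h5 + 4 * (hJZ + hJW) -
    (Real.pi : ℂ) ^ 4 / 3 * pi_pow_six_eq_MZV
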